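/- Reduction to generic matrices: let k be a field, s ≥ 1, and suppose f, g ∈ k⟨x_1,…,x_s⟩ commute (fg = gf) and are algebraically independent over k. For each n ≥ 1 let π_n : k⟨x_1,…,x_s⟩ → M_n(R_n) be the unique k-algebra homomorphism sending the ν-th free generator to the ν-th generic n×n matrix X_ν. Then there exists N such that for all n ≥ N the images π_n(f) and π_n(g) are algebraically independent over k. -/

import Mathlib

/-- Evaluation of a two-variable polynomial `P ∈ k[U,V]` at a pair of elements `u, v`
of a (possibly noncommutative) `k`-algebra: `∑_{(a,b)} P_{a,b} • u^a * v^b`. -/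
noncomputable def pairEval {k A : Type*} [CommSemiring k] [Semiring A] [Algebra k A]
    (P : MvPolynomial (Fin 2) k) (u v : A) : A :=
  ∑ m ∈ P.support, MvPolynomial.coeff m P • (u ^ (m 0) * v ^ (m 1))

/-- The `ν`-th generic `n×n` matrix over the field `k`. -/
noncomputable def genericMatrix (k : Type*) [Field k] (s n : ℕ) (ν : Fin s) :
    Matrix (Fin n) (Fin n) (MvPolynomial (Fin s × Fin n × Fin n) k) :=
  Matrix.of fun i j => MvPolynomial.X (ν, i, j)

namespace GenericReduction

variable {k : Type*} [Field k] {X : Type*}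

/-- All words in the support of `a` have length at most `d`. -/
def Bdd (d : ℕ) (a : MonoidAlgebra k (FreeMonoid X)) : Prop :=
  ∀ w, a.coeff w ≠ 0 → FreeMonoid.length w ≤ d

/-- The coefficient of a product at a product of two words of maximal length. -/
lemma coeff_top {m n : ℕ} {a b : MonoidAlgebra k (FreeMonoid X)} (ha : Bdd m a) (hb : Bdd n b)
    {p q : FreeMonoid X} (hp : FreeMonoid.length p = m) (hq : FreeMonoid.length q = n) :
    (a * b).coeff (p * q) = a.coeff p * b.coeff q := by
  apply MonoidAlgebra.coeff_mul_mul_of_uniqueMul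
  intro x y hx hy hxy
  have h1 := ha x (Finsupp.mem_support_iff.mp hx)
  have h2 := hb y (Finsupp.mem_support_iff.mp hy)
  have h3 := congrArg FreeMonoid.length hxy
  rw [FreeMonoid.length_mul, FreeMonoid.length_mul] at h3
  have h4 : FreeMonoid.toList x ++ FreeMonoid.toList y
      = FreeMonoid.toList p ++ FreeMonoid.toList q := by
    rw [← FreeMonoid.toList_mul, ← FreeMonoid.toList_mul, hxy]
  have h5 : x.length = p.length := by omega
  exact List.append_inj h4 h5

lemma Bdd.mul {m n : ℕ} {a b : MonoidAlgebra k (FreeMonoid X)} (ha : Bdd m a) (hb : Bdd n b) :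
    Bdd (m + n) (a * b) := by
  classical
  intro w hw
  by_contra hlt
  apply hw
  rw [MonoidAlgebra.coeff_mul, Finsupp.sum]
  apply Finset.sum_eq_zero
  intro x hx
  apply Finset.sum_eq_zero
  intro y hy
  have h1 := ha x (Finsupp.mem_support_iff.mp hx)
  have h2 := hb y (Finsupp.mem_support_iff.mp hy)
  refine if_neg ?_
  rintro rfl
  rw [FreeMonoid.length_mul] at hlt
  omega

lemma Bdd.mono {m n : ℕ} (h : m ≤ n) {a : MonoidAlgebra k (FreeMonoid X)} (ha : Bdd m a) :
    Bdd n a := fun w hw => (ha w hw).trans h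

lemma bdd_one : Bdd 0 (1 : MonoidAlgebra k (FreeMonoid X)) := by
  classical
  intro w hw
  rw [MonoidAlgebra.one_def, MonoidAlgebra.coeff_single, Finsupp.single_apply] at hw
  have : 1 = w := by
    by_contra h
    exact hw (if_neg h)
  rw [← this]
  simp

lemma Bdd.pow {m : ℕ} {a : MonoidAlgebra k (FreeMonoid X)} (ha : Bdd m a) (n : ℕ) :
    Bdd (n * m) (a ^ n) := by
  induction n with
  | zero => simpa using bdd_one
  | succ n ih =>
    rw [pow_succ, Nat.succ_mul]
    exact ih.mul ha

lemma coeff_pow {m : ℕ} {a : MonoidAlgebra k (FreeMonoid X)} (ha : Bdd m a)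
    {p : FreeMonoid X} (hp : p.length = m) (n : ℕ) :
    (a ^ n).coeff (p ^ n) = (a.coeff p) ^ n ∧ (p ^ n).length = n * m := by
  induction n with
  | zero => simp [MonoidAlgebra.one_def]
  | succ n ih =>
    rw [pow_succ, pow_succ, coeff_top (ha.pow n) ha ih.2 hp, ih.1, pow_succ,
      FreeMonoid.length_mul, ih.2, hp, Nat.succ_mul]
    exact ⟨rfl, rfl⟩

/-- An element of bounded degree commuting with `F` is determined by its coefficients at the
prefixes of a leading word of `F`. -/
lemma eq_zero_of_initial_coeffs {M : ℕ} {F : MonoidAlgebra k (FreeMonoid X)} (hF : Bdd M F)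
    {p : FreeMonoid X} (hp : p.length = M) (hFp : F.coeff p ≠ 0)
    {a : MonoidAlgebra k (FreeMonoid X)} (hc : a * F = F * a) (d : ℕ) (hd : d ≤ M)
    (ha : Bdd d a)
    (h0 : ∀ i ≤ d, a.coeff (FreeMonoid.ofList (p.toList.take i)) = 0) : a = 0 := by
  have key : ∀ e ≤ d, Bdd e a → ∀ w : FreeMonoid X, w.length = e → a.coeff w = 0 := by
    intro e he hae w hw
    have hl : p.toList.length = M := hp
    have hw' : w.toList.length = e := hw
    have e1 := coeff_top hF hae hp hw
    have hlen1 : (FreeMonoid.ofList (p.toList.take e)).length = e := by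
      change (p.toList.take e).length = e
      rw [List.length_take]
      omega
    have hlen2 : (FreeMonoid.ofList (p.toList.drop e ++ w.toList)).length = M := by
      change (p.toList.drop e ++ w.toList).length = M
      rw [List.length_append, List.length_drop]
      omega
    have e2 := coeff_top hae hF hlen1 hlen2
    have e3 : FreeMonoid.ofList (p.toList.take e) *
        FreeMonoid.ofList (p.toList.drop e ++ w.toList) = p * w := by
      apply FreeMonoid.toList.injective
      rw [FreeMonoid.toList_mul, FreeMonoid.toList_mul, FreeMonoid.toList_ofList,
        FreeMonoid.toList_ofList, ← List.append_assoc, List.take_append_drop]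
    rw [e3, hc, e1, h0 e he, zero_mul] at e2
    exact (mul_eq_zero.mp e2).resolve_left hFp
  clear h0
  have hz : Bdd 0 a := by
    have : ∀ j ≤ d, Bdd (d - j) a := by
      intro j
      induction j with
      | zero => intro _; exact ha
      | succ j ih =>
        intro hj w hw
        have hb := ih (by omega)
        have h1 := hb w hw
        have h2 : w.length ≠ d - j := fun h => hw (key _ (by omega) hb w h)
        omega
    simpa using this d le_rfl
  ext w
  by_contra hw
  have h1 : a.coeff w ≠ 0 := hw
  exact h1 (key 0 (Nat.zero_le _) hz w (Nat.le_zero.mp (hz w h1)))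

/-- Commuting elements have linearly dependent monomials. -/
lemma dependent (f g : MonoidAlgebra k (FreeMonoid X)) (hc : f * g = g * f)
    (hli : LinearIndependent k (fun m : ℕ × ℕ => f ^ m.1 * g ^ m.2)) : False := by
  classical
  have hbd : ∀ a : MonoidAlgebra k (FreeMonoid X), Bdd (a.coeff.support.sup FreeMonoid.length) a :=
    fun a w hw => Finset.le_sup (f := FreeMonoid.length) (Finsupp.mem_support_iff.mpr hw)
  have hf0 : f ≠ 0 := by
    have := hli.ne_zero (1, 0)
    simpa using this
  have hne : f.coeff.support.Nonempty := by
    rw [Finsupp.support_nonempty_iff]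
    simpa using hf0
  obtain ⟨p, hpm, hp⟩ := Finset.exists_mem_eq_sup _ hne FreeMonoid.length
  have hfp : f.coeff p ≠ 0 := Finsupp.mem_support_iff.mp hpm
  have hbf := hbd f
  have hbg := hbd g
  generalize f.coeff.support.sup FreeMonoid.length = df at hp hbf
  generalize g.coeff.support.sup FreeMonoid.length = dg at hbg
  -- `f` is not a scalar
  have hdf : 1 ≤ df := by
    by_contra hlt
    have hdf : df = 0 := by omega
    subst hdf
    have hfs : f = f.coeff 1 • (1 : MonoidAlgebra k (FreeMonoid X)) := by
      ext w
      by_cases hw : w = 1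
      · subst hw
        simp [MonoidAlgebra.one_def]
      · have : f.coeff w = 0 := by
          by_contra h
          exact hw (FreeMonoid.length_eq_zero.mp (Nat.le_zero.mp (hbf w h)))
        simp [MonoidAlgebra.one_def, this, Ne.symm hw]
    have h2 := LinearIndependent.pair_iff.mp
      (hli.comp (fun b : Fin 2 => if b = 0 then ((1, 0) : ℕ × ℕ) else (0, 0))
        (by intro a b; fin_cases a <;> fin_cases b <;> simp) |> fun h => by
          have : (fun m : ℕ × ℕ => f ^ m.1 * g ^ m.2) ∘
            (fun b : Fin 2 => if b = 0 then ((1, 0) : ℕ × ℕ) else (0, 0)) = ![f, 1] := by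
            funext b; fin_cases b <;> simp
          rwa [this] at h) 1 (-(f.coeff 1)) (by rw [one_smul, neg_smul, ← hfs, add_neg_cancel])
    exact one_ne_zero h2.1
  set T := df + dg with hT
  set D := T * T with hD
  have hF := hbf.pow D
  obtain ⟨hcp, hlp⟩ := coeff_pow hbf hp.symm D
  have hFp : (f ^ D).coeff (p ^ D) ≠ 0 := by rw [hcp]; exact pow_ne_zero _ hfp
  let v : Fin (T + 1) × Fin (T + 1) → MonoidAlgebra k (FreeMonoid X) :=
    fun m => f ^ (m.1 : ℕ) * g ^ (m.2 : ℕ)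
  have hv : LinearIndependent k v :=
    hli.comp (fun m : Fin (T + 1) × Fin (T + 1) => ((m.1 : ℕ), (m.2 : ℕ))) (by
      rintro ⟨a, b⟩ ⟨c, d⟩ h
      simp only [Prod.mk.injEq] at h
      exact Prod.ext (Fin.ext h.1) (Fin.ext h.2))
  let w : Fin (D + 1) → FreeMonoid X := fun i => FreeMonoid.ofList ((p ^ D).toList.take i)
  let Φ : (Fin (T + 1) × Fin (T + 1) → k) →ₗ[k] (Fin (D + 1) → k) :=
    { toFun := fun c i => ∑ m, c m * (v m).coeff (w i)
      map_add' := by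
        intro c c'
        funext i
        simp [add_mul, Finset.sum_add_distrib]
      map_smul' := by
        intro r c
        funext i
        simp [Finset.mul_sum, mul_assoc] }
  have hker : LinearMap.ker Φ ≠ ⊥ := by
    apply LinearMap.ker_ne_bot_of_finrank_lt
    rw [Module.finrank_fintype_fun_eq_card, Module.finrank_fintype_fun_eq_card]
    simp only [Fintype.card_prod, Fintype.card_fin]
    rw [hD]
    have : 1 ≤ T := by omega
    nlinarith
  obtain ⟨c, hcΦ, hc0⟩ := Submodule.exists_mem_ne_zero_of_ne_bot hker
  have hcz : ∀ i, ∑ m, c m * (v m).coeff (w i) = 0 := fun i => congrFun hcΦ i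
  have hcoeff : ∀ u, (∑ m, c m • v m).coeff u = ∑ m, c m * (v m).coeff u := by
    intro u
    rw [MonoidAlgebra.coeff_sum, Finsupp.finsetSum_apply]
    simp
  have hvb : ∀ m, Bdd D (v m) := by
    intro m
    refine Bdd.mono ?_ ((hbf.pow m.1).mul (hbg.pow m.2))
    have h1 : (m.1 : ℕ) ≤ T := by omega
    have h2 : (m.2 : ℕ) ≤ T := by omega
    calc (m.1 : ℕ) * df + m.2 * dg ≤ T * df + T * dg := by gcongr
      _ = D := by rw [hD, ← mul_add]
  have hvc : ∀ m, Commute (v m) (f ^ D) := by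
    intro m
    have hfg : Commute f g := hc
    exact ((Commute.refl f).pow_pow _ _).mul_left (hfg.symm.pow_pow _ _)
  have hzero : ∑ m, c m • v m = 0 := by
    refine eq_zero_of_initial_coeffs hF hlp hFp ?_ D ?_ ?_ ?_
    · exact Commute.sum_left _ _ _ (fun m _ => (hvc m).smul_left _)
    · exact Nat.le_mul_of_pos_right _ hdf
    · intro u hu
      rw [hcoeff] at hu
      obtain ⟨m, _, hm⟩ := Finset.exists_ne_zero_of_sum_ne_zero hu
      exact hvb m u (right_ne_zero_of_mul hm)
    · intro i hi
      rw [hcoeff]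
      exact hcz ⟨i, by omega⟩
  exact hc0 (funext (Fintype.linearIndependent_iff.mp hv c hzero))

end GenericReduction

/-- **Reduction to generic matrices.** If `f, g` are commuting, algebraically
independent elements of the free associative algebra `k⟨x_1,…,x_s⟩`, then for all
sufficiently large `n` their images under the canonical homomorphism
`π_n : k⟨x_1,…,x_s⟩ → M_n(R_n)` (sending the `ν`-th free generator to the `ν`-th
generic `n×n` matrix) are algebraically independent over `k`. -/
theorem reduction_to_generic_matrices (k : Type*) [Field k] (s : ℕ) (hs : 1 ≤ s)
    (f g : FreeAlgebra k (Fin s)) (hcomm : f * g = g * f)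
    (hindep : ∀ P : MvPolynomial (Fin 2) k, pairEval P f g = 0 → P = 0) :
    ∃ N : ℕ, ∀ n : ℕ, N ≤ n →
      ∀ P : MvPolynomial (Fin 2) k,
        pairEval P (FreeAlgebra.lift k (genericMatrix k s n) f)
          (FreeAlgebra.lift k (genericMatrix k s n) g) = 0 → P = 0 := by
  exfalso
  have h1 : LinearIndependent k (fun m : Fin 2 →₀ ℕ => f ^ m 0 * g ^ m 1) := by
    rw [linearIndependent_iff]
    intro l hl
    have := hindep (AddMonoidAlgebra.ofCoeff l) hl
    exact congrArg AddMonoidAlgebra.coeff this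
  have h2 : LinearIndependent k (fun m : ℕ × ℕ => f ^ m.1 * g ^ m.2) := by
    have h3 := h1.comp (fun m : ℕ × ℕ => Finsupp.equivFunOnFinite.symm ![m.1, m.2]) (by
      rintro ⟨a, b⟩ ⟨c, d⟩ h
      have h' := Finsupp.equivFunOnFinite.symm.injective h
      have e0 := congrFun h' 0
      have e1 := congrFun h' 1
      exact Prod.ext e0 e1)
    exact h3
  let φ := FreeAlgebra.equivMonoidAlgebraFreeMonoid (R := k) (X := Fin s)
  refine GenericReduction.dependent (φ f) (φ g) (by rw [← map_mul, hcomm, map_mul]) ?_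
  have h4 := h2.map' φ.toLinearMap (LinearMap.ker_eq_bot.mpr φ.injective)
  have h5 : (φ.toLinearMap ∘ fun m : ℕ × ℕ => f ^ m.1 * g ^ m.2)
      = fun m : ℕ × ℕ => φ f ^ m.1 * φ g ^ m.2 := by
    funext m
    simp
  rw [h5] at h4
  exact h4
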